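/- arXiv:math/0305410 — 2 statements merged into one kernel-verified Lean document; each statement's English description precedes it below -/
import Mathlib

section
/- Let K be a convex body in ℝⁿ with centroid at the origin. Then E U_K² = ((n+1) / n!) · det M / |K|^{n+2}, where M is the n × n matrix with entries M_{ij} = ∫_K x_i x_j dx. -/
open MeasureTheory

/-- The uniform probability measure on a set `K` in `ℝⁿ`. -/
noncomputable def unifMeasure (n : ℕ) (K : Set (EuclideanSpace ℝ (Fin n))) :
    Measure (EuclideanSpace ℝ (Fin n)) :=
  (volume K)⁻¹ • volume.restrict K

/-- The joint distribution of `N` independent uniform random points in `K`. -/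
noncomputable def jointUnif (n N : ℕ) (K : Set (EuclideanSpace ℝ (Fin n))) :
    Measure (Fin N → EuclideanSpace ℝ (Fin n)) :=
  Measure.pi fun _ => unifMeasure n K

/-- `U_K`: the normalized volume of the convex hull of `n+1` points. -/
noncomputable def randSimplexVol (n : ℕ) (K : Set (EuclideanSpace ℝ (Fin n)))
    (x : Fin (n + 1) → EuclideanSpace ℝ (Fin n)) : ℝ :=
  (volume (convexHull ℝ (Set.range x))).toReal / (volume K).toReal

/-- The matrix of second moments (inertia matrix) of `K`: `M i j = ∫_K x_i x_j dx`. -/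
noncomputable def inertiaMatrix (n : ℕ) (K : Set (EuclideanSpace ℝ (Fin n))) :
    Matrix (Fin n) (Fin n) ℝ :=
  Matrix.of fun i j => ∫ x in K, x i * x j

/-- The corner simplex `{y ≥ 0, ∑ yᵢ ≤ t}` is measurable. -/
theorem measurableSet_cornerSimplex (n : ℕ) (t : ℝ) :
    MeasurableSet {y : Fin n → ℝ | (∀ i, 0 ≤ y i) ∧ ∑ i, y i ≤ t} := by
  refine IsClosed.measurableSet (IsClosed.inter (s₁ := {y : Fin n → ℝ | ∀ i, 0 ≤ y i})
    (s₂ := {y : Fin n → ℝ | ∑ i, y i ≤ t}) ?_ ?_)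
  · simp only [Set.ofPred_forall]
    exact isClosed_iInter fun i => isClosed_le continuous_const (continuous_apply i)
  · exact isClosed_le (by fun_prop) continuous_const

/-- The corner simplex `{y ≥ 0, ∑ yᵢ ≤ t}` in `ℝⁿ` has volume `tⁿ / n!`. -/
theorem volume_cornerSimplex (n : ℕ) (t : ℝ) (ht : 0 ≤ t) :
    volume {y : Fin n → ℝ | (∀ i, 0 ≤ y i) ∧ ∑ i, y i ≤ t} =
      ENNReal.ofReal (t ^ n / n.factorial) := by
  induction n generalizing t with
  | zero => simp [ht, volume_pi]
  | succ n ih =>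
    have e := (volume_preserving_piFinSuccAbove (fun _ : Fin (n + 1) => ℝ) 0).symm
    rw [← e.measure_preimage (measurableSet_cornerSimplex _ t).nullMeasurableSet,
      Measure.volume_eq_prod,
      Measure.prod_apply ((MeasurableEquiv.measurable _) (measurableSet_cornerSimplex _ t))]
    have hsec : ∀ a : ℝ, volume (Prod.mk a ⁻¹'
        ((MeasurableEquiv.piFinSuccAbove (fun _ : Fin (n + 1) => ℝ) 0).symm ⁻¹'
          {y : Fin (n + 1) → ℝ | (∀ i, 0 ≤ y i) ∧ ∑ i, y i ≤ t})) =
        (Set.Icc 0 t).indicator (fun a => ENNReal.ofReal ((t - a) ^ n / n.factorial)) a := by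
      intro a
      have hset : (Prod.mk a ⁻¹'
        ((MeasurableEquiv.piFinSuccAbove (fun _ : Fin (n + 1) => ℝ) 0).symm ⁻¹'
          {y : Fin (n + 1) → ℝ | (∀ i, 0 ≤ y i) ∧ ∑ i, y i ≤ t})) =
          {y : Fin n → ℝ | 0 ≤ a ∧ (∀ i, 0 ≤ y i) ∧ ∑ i, y i ≤ t - a} := by
        ext y
        simp [MeasurableEquiv.piFinSuccAbove, Fin.forall_fin_succ, Fin.sum_univ_succ,
          le_sub_iff_add_le', and_assoc]
      rw [hset]
      by_cases ha : a ∈ Set.Icc 0 t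
      · rw [Set.indicator_of_mem ha, ← ih (t - a) (sub_nonneg.2 ha.2)]
        simp [ha.1]
      · rw [Set.indicator_of_notMem ha]
        convert measure_empty (μ := (volume : Measure (Fin n → ℝ)))
        refine Set.eq_empty_of_forall_notMem fun y hy => ha ⟨hy.1, ?_⟩
        have := Finset.sum_nonneg fun i (_ : i ∈ Finset.univ) => hy.2.1 i
        linarith [hy.2.2]
    simp_rw [hsec]
    rw [lintegral_indicator measurableSet_Icc, ← ofReal_integral_eq_lintegral_ofReal]
    · congr 1
      rw [integral_Icc_eq_integral_Ioc, ← intervalIntegral.integral_of_le ht,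
        intervalIntegral.integral_div,
        intervalIntegral.integral_comp_sub_left (fun x => x ^ n) t]
      simp only [sub_self, sub_zero, integral_pow, ne_eq, Nat.add_eq_zero_iff, one_ne_zero,
        and_false, not_false_eq_true, zero_pow, Nat.factorial_succ, Nat.cast_mul, Nat.cast_add,
        Nat.cast_one]
      field_simp
    · exact Continuous.integrableOn_Icc (by fun_prop)
    · filter_upwards [ae_restrict_mem measurableSet_Icc] with a ha
      have := sub_nonneg.2 ha.2
      positivity

open scoped Pointwise in
/-- A simplex is the affine image of the corner simplex. -/
theorem convexHull_range_eq_vadd_image {E : Type*} [AddCommGroup E] [Module ℝ E] {n : ℕ}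
    (x : Fin (n + 1) → E) :
    convexHull ℝ (Set.range x) =
      x 0 +ᵥ (Fintype.linearCombination ℝ fun i : Fin n => x i.succ - x 0) ''
        {y : Fin n → ℝ | (∀ i, 0 ≤ y i) ∧ ∑ i, y i ≤ 1} := by
  have h : convexHull ℝ (Set.range x) =
      Fintype.linearCombination ℝ x '' stdSimplex ℝ (Fin (n + 1)) := by
    rw [← convexHull_rangle_single_eq_stdSimplex, LinearMap.image_convexHull, ← Set.range_comp]
    congr 2
    ext i
    simp
  rw [h]
  ext p
  simp only [Set.mem_vadd_set, Set.mem_image, Fintype.linearCombination_apply, stdSimplex,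
    Set.mem_ofPred_eq, vadd_eq_add, Fin.sum_univ_succ, Fin.forall_fin_succ, smul_sub,
    Finset.sum_sub_distrib, ← Finset.sum_smul]
  constructor
  · rintro ⟨w, ⟨⟨hw0, hw⟩, hsum⟩, rfl⟩
    refine ⟨_, ⟨fun i => w i.succ, ⟨hw, by linarith⟩, rfl⟩, ?_⟩
    rw [← eq_sub_iff_add_eq] at hsum
    rw [hsum, sub_smul, one_smul]
    abel
  · rintro ⟨_, ⟨y, ⟨hy, hsum⟩, rfl⟩, rfl⟩
    refine ⟨Fin.cons (1 - ∑ i, y i) y, ⟨⟨by simpa using hsum, by simpa using hy⟩, by simp⟩, ?_⟩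
    simp only [Fin.cons_zero, Fin.cons_succ, sub_smul, one_smul]
    abel

/-- The determinant with rows `(1, xᵢ)` equals the determinant of the edge vectors at `x₀`. -/
theorem det_cons_one_eq_det_sub {n : ℕ} (x : Fin (n + 1) → Fin n → ℝ) :
    (Matrix.of fun i j => (Fin.cons 1 (x i) : Fin (n + 1) → ℝ) j).det =
      (Matrix.of fun i j => x (Fin.succ i) j - x 0 j).det := by
  rw [Matrix.det_eq_of_forall_row_eq_smul_add_const
    (B := Matrix.of (Fin.cons (Fin.cons 1 (x 0))
      (fun i => Fin.cons 0 (fun j => x (Fin.succ i) j - x 0 j))))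
    (Fin.cons 0 fun _ => 1) 0 rfl, Matrix.det_succ_column_zero, Fin.sum_univ_succ]
  · simp
    rfl
  · intro i j
    refine Fin.cases ?_ (fun i => ?_) i <;> refine Fin.cases ?_ (fun j => ?_) j <;> simp

open scoped Pointwise in
/-- The volume of a simplex as a determinant. -/
theorem volume_convexHull_range {n : ℕ} (x : Fin (n + 1) → EuclideanSpace ℝ (Fin n)) :
    (volume (convexHull ℝ (Set.range x))).toReal =
      |(Matrix.of fun i j => (Fin.cons 1 (x i) : Fin (n + 1) → ℝ) j).det| / n.factorial := by
  have himg : convexHull ℝ (Set.range x) = x 0 +ᵥ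
      (Fintype.linearCombination ℝ (fun i : Fin n => x i.succ - x 0) ∘ₗ
        (WithLp.linearEquiv 2 ℝ (Fin n → ℝ)).toLinearMap) ''
      (WithLp.ofLp ⁻¹' {y : Fin n → ℝ | (∀ i, 0 ≤ y i) ∧ ∑ i, y i ≤ 1}) := by
    rw [convexHull_range_eq_vadd_image, LinearMap.coe_comp, Set.image_comp]
    congr 2
    exact (Set.image_preimage_eq _ (WithLp.linearEquiv 2 ℝ (Fin n → ℝ)).surjective).symm
  rw [himg, measure_vadd, Measure.addHaar_image_linearMap,
    (PiLp.volume_preserving_ofLp (Fin n)).measure_preimage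
      (measurableSet_cornerSimplex n 1).nullMeasurableSet,
    volume_cornerSimplex n 1 zero_le_one, ENNReal.toReal_mul,
    ENNReal.toReal_ofReal (abs_nonneg _), ENNReal.toReal_ofReal (by positivity), one_pow,
    mul_one_div, det_cons_one_eq_det_sub (fun i => x i), ← Matrix.det_transpose,
    ← LinearMap.det_toMatrix (EuclideanSpace.basisFun (Fin n) ℝ).toBasis]
  congr 3
  ext i j
  simp [LinearMap.toMatrix_apply, Fintype.linearCombination_apply]

/-- The second moment of the determinant of a random matrix with i.i.d. rows. -/
theorem integral_det_sq_pi {α ι : Type*} [MeasurableSpace α] [Fintype ι] [DecidableEq ι]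
    (μ : Measure α) [SigmaFinite μ] (f : ι → α → ℝ)
    (hf : ∀ i j, Integrable (fun a => f i a * f j a) μ) :
    ∫ x : ι → α, (Matrix.of fun i j => f j (x i)).det ^ 2 ∂(Measure.pi fun _ => μ) =
      (Fintype.card ι).factorial * (Matrix.of fun i j => ∫ a, f i a * f j a ∂μ).det := by
  have hexp : ∀ x : ι → α, (Matrix.of fun i j => f j (x i)).det ^ 2 =
      ∑ σ : Equiv.Perm ι, ∑ τ : Equiv.Perm ι, ((σ.sign : ℤ) : ℝ) * ((τ.sign : ℤ) : ℝ) *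
        ∏ i, (f (σ i) (x i) * f (τ i) (x i)) := by
    intro x
    rw [← Matrix.det_transpose, Matrix.det_apply', sq, Finset.sum_mul_sum]
    refine Finset.sum_congr rfl fun σ _ => Finset.sum_congr rfl fun τ _ => ?_
    simp only [Matrix.transpose_apply, Matrix.of_apply, Finset.prod_mul_distrib]
    ring
  have hint : ∀ σ τ : Equiv.Perm ι, Integrable (fun x : ι → α =>
      ((σ.sign : ℤ) : ℝ) * ((τ.sign : ℤ) : ℝ) * ∏ i, (f (σ i) (x i) * f (τ i) (x i)))
      (Measure.pi fun _ => μ) := fun σ τ =>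
    (Integrable.fintype_prod (f := fun i a => f (σ i) a * f (τ i) a)
      fun i => hf (σ i) (τ i)).const_mul _
  simp_rw [hexp]
  rw [integral_finsetSum _ fun σ _ => integrable_finsetSum _ fun τ _ => hint σ τ]
  simp_rw [integral_finsetSum _ fun τ _ => hint _ τ, integral_const_mul]
  have hdet : ∀ σ : Equiv.Perm ι, ∑ τ : Equiv.Perm ι, ((σ.sign : ℤ) : ℝ) * ((τ.sign : ℤ) : ℝ) *
      ∫ x : ι → α, ∏ i, (f (σ i) (x i) * f (τ i) (x i)) ∂(Measure.pi fun _ => μ) =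
      (Matrix.of fun i j => ∫ a, f i a * f j a ∂μ).det := by
    intro σ
    have hprod : ∀ τ : Equiv.Perm ι,
        ∫ x : ι → α, ∏ i, (f (σ i) (x i) * f (τ i) (x i)) ∂(Measure.pi fun _ => μ) =
          ∏ i, ∫ a, f (σ i) a * f (τ i) a ∂μ := fun τ =>
      integral_fintype_prod_eq_prod (fun i a => f (σ i) a * f (τ i) a)
    have hperm := Matrix.det_permute σ (Matrix.of fun i j => ∫ a, f i a * f j a ∂μ)
    rw [← Matrix.det_transpose, Matrix.det_apply'] at hperm
    simp only [Matrix.transpose_apply, Matrix.submatrix_apply, Matrix.of_apply, id] at hperm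
    simp_rw [hprod, mul_assoc, ← Finset.mul_sum]
    rw [hperm, ← mul_assoc, ← Int.cast_mul, ← Units.val_mul, Int.units_mul_self]
    simp
  simp_rw [hdet]
  simp [Fintype.card_perm]

/-- For a convex body `K ⊆ ℝⁿ` with centroid at the origin,
`𝔼 U_K² = ((n+1) / n!) · det [∫_K x_i x_j dx] / |K|^{n+2}`. -/
theorem second_moment_randSimplexVol
    (n : ℕ) (hn : 0 < n)
    (K : Set (EuclideanSpace ℝ (Fin n)))
    (hK_conv : Convex ℝ K) (hK_comp : IsCompact K)
    (hK_int : (interior K).Nonempty)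
    (hK_centroid : ∫ x in K, x = (0 : EuclideanSpace ℝ (Fin n))) :
    ∫ x, randSimplexVol n K x ^ 2 ∂(jointUnif n (n + 1) K) =
      ((n + 1 : ℝ) / (n.factorial : ℝ)) *
        (inertiaMatrix n K).det / (volume K).toReal ^ (n + 2) := by
  have hV0 : volume K ≠ 0 := (Measure.measure_pos_of_nonempty_interior _ hK_int).ne'
  have hVt : volume K ≠ ⊤ := hK_comp.measure_lt_top.ne
  have hV : (volume K).toReal ≠ 0 := ENNReal.toReal_ne_zero.2 ⟨hV0, hVt⟩
  have hfin : IsFiniteMeasure (unifMeasure n K) := by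
    have : IsFiniteMeasure (volume.restrict K) := ⟨by simpa using hK_comp.measure_lt_top⟩
    exact Measure.smul_finite _ (ENNReal.inv_ne_top.2 hV0)
  have hint : ∀ g : EuclideanSpace ℝ (Fin n) → ℝ, Continuous g → Integrable g (unifMeasure n K) :=
    fun g hg => (hg.continuousOn.integrableOn_compact hK_comp).smul_measure
      (ENNReal.inv_ne_top.2 hV0)
  have hval : ∀ g : EuclideanSpace ℝ (Fin n) → ℝ,
      ∫ a, g a ∂(unifMeasure n K) = (volume K).toReal⁻¹ * ∫ a in K, g a := fun g => by
    rw [unifMeasure, integral_smul_measure, ENNReal.toReal_inv, smul_eq_mul]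
  have hcent : ∀ i, ∫ a in K, a i = 0 := fun i => by
    have hid : Integrable (fun a : EuclideanSpace ℝ (Fin n) => a) (volume.restrict K) :=
      continuous_id.continuousOn.integrableOn_compact hK_comp
    have h := (EuclideanSpace.proj (𝕜 := ℝ) i).integral_comp_comm hid
    rw [hK_centroid] at h
    simpa using h
  let f : Fin (n + 1) → EuclideanSpace ℝ (Fin n) → ℝ :=
    fun j a => (Fin.cons 1 a.ofLp : Fin (n + 1) → ℝ) j
  have hf : ∀ j, Continuous (f j) := by
    refine Fin.cases ?_ fun j => ?_
    · exact continuous_const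
    · simpa [f] using (EuclideanSpace.proj (𝕜 := ℝ) j).continuous
  have hsq : ∀ x, randSimplexVol n K x ^ 2 = ((n.factorial : ℝ) * (volume K).toReal)⁻¹ ^ 2 *
      (Matrix.of fun i j => f j (x i)).det ^ 2 := fun x => by
    rw [randSimplexVol, volume_convexHull_range, div_div, div_pow, sq_abs, inv_pow,
      div_eq_inv_mul]
  have hgram : (Matrix.of fun i j => ∫ a, f i a * f j a ∂(unifMeasure n K)).det =
      (volume K).toReal⁻¹ ^ n * (inertiaMatrix n K).det := by
    rw [Matrix.det_succ_column_zero, Fin.sum_univ_succ, Finset.sum_eq_zero]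
    · have hsub : (Matrix.of fun i j => ∫ a, f i a * f j a ∂(unifMeasure n K)).submatrix
          (Fin.succAbove 0) Fin.succ = (volume K).toReal⁻¹ • inertiaMatrix n K := by
        ext i j
        simp [f, hval, inertiaMatrix]
      rw [hsub, Matrix.det_smul]
      simp [f, hval, Measure.real, hV]
    · intro i _
      simp [f, hval, hcent]
  simp_rw [hsq]
  rw [integral_const_mul, jointUnif,
    integral_det_sq_pi _ f fun i j => hint _ ((hf i).mul (hf j)), hgram, Fintype.card_fin,
    Nat.factorial_succ, inv_pow _ n]
  push_cast
  field_simp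
  ring
end

section
/- For 1 ≤ q < ∞, E V_{B_qⁿ}² = (1/n!) · ( Γ(1 + 3/q) Γ(1 + n/q) / (3 Γ(1 + 1/q)³ Γ(1 + (n+2)/q)) )ⁿ · Γ(1 + n/q)². -/
open MeasureTheory Pointwise

/-- The unit ball of `ℓ_qⁿ`: `B_qⁿ = { x ∈ ℝⁿ : Σ |x_i|^q ≤ 1 }`. -/
noncomputable def lqBall (n : ℕ) (q : ℝ) : Set (EuclideanSpace ℝ (Fin n)) :=
  {x | ∑ i, |x i| ^ q ≤ 1}

/-- `V_K`: the normalized volume of the symmetric convex hull of `n` points. -/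
noncomputable def randCrossVol (n : ℕ) (K : Set (EuclideanSpace ℝ (Fin n)))
    (x : Fin n → EuclideanSpace ℝ (Fin n)) : ℝ :=
  (volume (convexHull ℝ (Set.range x ∪ -Set.range x))).toReal / (volume K).toReal

theorem rpow_le_one_iff_of_nonneg {x y : ℝ} (hx : 0 ≤ x) (hy : 0 < y) : x ^ y ≤ 1 ↔ x ≤ 1 := by
  simpa using Real.rpow_le_rpow_iff hx zero_le_one hy

theorem integral_rpow_abs_mul_exp_neg_rpow {q : ℝ} (hq : 0 < q) (s : ℝ) (hs : 0 ≤ s) :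
    ∫ u : ℝ, |u| ^ s * Real.exp (-|u| ^ q) =
      2 / (s + 1) * Real.Gamma (1 + (s + 1) / q) := by
  rw [integral_comp_abs (f := fun u => u ^ s * Real.exp (-u ^ q)),
    integral_rpow_mul_exp_neg_rpow hq (by linarith), add_comm (1 : ℝ),
    Real.Gamma_add_one (by positivity)]
  field_simp

theorem integral_sq_mul_exp_neg_sum_rpow {n : ℕ} {q : ℝ} (hq : 0 < q) (i : Fin n) :
    ∫ x : Fin n → ℝ, x i ^ 2 * Real.exp (-∑ k, |x k| ^ q) =
      2 / 3 * Real.Gamma (1 + 3 / q) * (2 * Real.Gamma (1 + 1 / q)) ^ (n - 1) := by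
  have h (x : Fin n → ℝ) : x i ^ 2 * Real.exp (-∑ k, |x k| ^ q) =
      ∏ k, |x k| ^ (if k = i then (2 : ℝ) else 0) * Real.exp (-|x k| ^ q) := by
    rw [Finset.prod_mul_distrib, ← Real.exp_sum, Finset.sum_neg_distrib,
      Finset.prod_eq_single i (by intro k _ hk; simp [hk]) (by simp)]
    simp
  simp_rw [h]
  rw [integral_fintype_prod_volume_eq_prod
    (fun k (u : ℝ) => |u| ^ (if k = i then (2 : ℝ) else 0) * Real.exp (-|u| ^ q)),
    ← Finset.mul_prod_erase _ _ (Finset.mem_univ i),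
    Finset.prod_congr rfl (g := fun _ => 2 * Real.Gamma (1 + 1 / q))]
  · rw [Finset.prod_const, Finset.card_erase_of_mem (Finset.mem_univ i), Finset.card_fin, if_pos rfl,
      integral_rpow_abs_mul_exp_neg_rpow hq 2 (by norm_num)]
    norm_num
  · intro k hk
    rw [if_neg (Finset.ne_of_mem_erase hk), integral_rpow_abs_mul_exp_neg_rpow hq 0 le_rfl]
    norm_num

theorem setLIntegral_sq_sum_rpow_le {n : ℕ} {q : ℝ} (hq : 0 < q) (i : Fin n) {t : ℝ} (ht : 0 < t) :
    ∫⁻ x in {x : Fin n → ℝ | ∑ k, |x k| ^ q ≤ t}, ENNReal.ofReal (x i ^ 2) =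
      ENNReal.ofReal (t ^ (((n : ℝ) + 2) / q)) *
        ∫⁻ x in {x : Fin n → ℝ | ∑ k, |x k| ^ q ≤ 1}, ENNReal.ofReal (x i ^ 2) := by
  set r : ℝ := t ^ (1 / q) with hr
  have hr0 : 0 < r := by positivity
  have hrq : r ^ q = t := by
    rw [hr, ← Real.rpow_mul ht.le, one_div_mul_cancel hq.ne', Real.rpow_one]
  have hmeas (s : ℝ) : MeasurableSet {x : Fin n → ℝ | ∑ k, |x k| ^ q ≤ s} :=
    measurableSet_le (by fun_prop) measurable_const
  have hscale : ∫⁻ x in {x : Fin n → ℝ | ∑ k, |x k| ^ q ≤ 1}, ENNReal.ofReal ((r * x i) ^ 2) =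
      ENNReal.ofReal |(r ^ n)⁻¹| *
        ∫⁻ x in {x : Fin n → ℝ | ∑ k, |x k| ^ q ≤ t}, ENNReal.ofReal (x i ^ 2) := by
    have hmap := Measure.map_addHaar_smul (volume : Measure (Fin n → ℝ)) hr0.ne'
    rw [Module.finrank_fin_fun] at hmap
    rw [← lintegral_indicator (hmeas t), ← lintegral_indicator (hmeas 1), ← smul_eq_mul,
      ← lintegral_smul_measure, ← hmap, lintegral_map
        (Measurable.indicator (by fun_prop) (hmeas t)) (by fun_prop)]
    refine lintegral_congr fun x => ?_
    have : (∑ k, |x k| ^ q ≤ 1) ↔ ∑ k, |(r • x) k| ^ q ≤ t := by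
      simp_rw [Pi.smul_apply, smul_eq_mul, abs_mul, abs_of_pos hr0,
        Real.mul_rpow hr0.le (abs_nonneg _), hrq, ← Finset.mul_sum]
      rw [mul_le_iff_le_one_right ht]
    simp only [Set.indicator, Set.mem_ofPred_eq, this]
    rfl
  simp_rw [mul_pow, ENNReal.ofReal_mul (sq_nonneg r)] at hscale
  rw [lintegral_const_mul _ (by fun_prop)] at hscale
  have hpow : t ^ (((n : ℝ) + 2) / q) = r ^ n * r ^ 2 := by
    rw [← pow_add, ← Real.rpow_natCast, hr, ← Real.rpow_mul ht.le]
    congr 1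
    push_cast
    ring
  rw [hpow, ENNReal.ofReal_mul (by positivity), mul_assoc, hscale, ← mul_assoc,
    ← ENNReal.ofReal_mul (by positivity), abs_of_pos (by positivity), mul_inv_cancel₀ (by positivity),
    ENNReal.ofReal_one, one_mul]

theorem lintegral_sq_mul_exp_neg_sum_rpow {n : ℕ} {q : ℝ} (hq : 0 < q) (i : Fin n) :
    ∫⁻ x : Fin n → ℝ, ENNReal.ofReal (x i ^ 2 * Real.exp (-∑ k, |x k| ^ q)) =
      ENNReal.ofReal (Real.Gamma (1 + ((n : ℝ) + 2) / q)) *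
        ∫⁻ x in {x : Fin n → ℝ | ∑ k, |x k| ^ q ≤ 1}, ENNReal.ofReal (x i ^ 2) := by
  have hmeas (s : ℝ) : MeasurableSet {x : Fin n → ℝ | ∑ k, |x k| ^ q ≤ s} :=
    measurableSet_le (by fun_prop) measurable_const
  have hexp (c : ℝ) : ENNReal.ofReal (Real.exp (-c)) =
      ∫⁻ t, (Set.Ici c).indicator (fun t => ENNReal.ofReal (Real.exp (-t))) t := by
    rw [lintegral_indicator measurableSet_Ici, ← restrict_Ioi_eq_restrict_Ici,
      ← integral_exp_neg_Ioi, ofReal_integral_eq_lintegral_ofReal (integrableOn_exp_neg_Ioi c)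
        (Filter.Eventually.of_forall fun t => (Real.exp_pos _).le)]
  have hjoint : Measurable fun p : (Fin n → ℝ) × ℝ => ENNReal.ofReal (p.1 i ^ 2) *
      (Set.Ici (∑ k, |p.1 k| ^ q)).indicator (fun t => ENNReal.ofReal (Real.exp (-t))) p.2 := by
    have hset : MeasurableSet {p : (Fin n → ℝ) × ℝ | ∑ k, |p.1 k| ^ q ≤ p.2} :=
      measurableSet_le (by fun_prop) (by fun_prop)
    exact Measurable.mul (by fun_prop) (Measurable.indicator
      (f := fun p : (Fin n → ℝ) × ℝ => ENNReal.ofReal (Real.exp (-p.2))) (by fun_prop) hset)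
  calc
    _ = ∫⁻ x : Fin n → ℝ, ∫⁻ t, ENNReal.ofReal (x i ^ 2) *
        (Set.Ici (∑ k, |x k| ^ q)).indicator (fun t => ENNReal.ofReal (Real.exp (-t))) t := by
      refine lintegral_congr fun x => ?_
      rw [ENNReal.ofReal_mul (sq_nonneg _), hexp, lintegral_const_mul _
        (Measurable.indicator (by fun_prop) measurableSet_Ici)]
    _ = ∫⁻ t, ∫⁻ x : Fin n → ℝ, ENNReal.ofReal (x i ^ 2) *
        (Set.Ici (∑ k, |x k| ^ q)).indicator (fun t => ENNReal.ofReal (Real.exp (-t))) t :=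
      lintegral_lintegral_swap hjoint.aemeasurable
    _ = ∫⁻ t, ENNReal.ofReal (Real.exp (-t)) *
        ∫⁻ x in {x : Fin n → ℝ | ∑ k, |x k| ^ q ≤ t}, ENNReal.ofReal (x i ^ 2) := by
      refine lintegral_congr fun t => ?_
      rw [← lintegral_indicator (hmeas t), ← lintegral_const_mul _
        (Measurable.indicator (by fun_prop) (hmeas t))]
      refine lintegral_congr fun x => ?_
      by_cases h : ∑ k, |x k| ^ q ≤ t <;> simp [Set.indicator, h, mul_comm]
    _ = ∫⁻ t in Set.Ioi (0 : ℝ), ENNReal.ofReal (Real.exp (-t)) *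
        ∫⁻ x in {x : Fin n → ℝ | ∑ k, |x k| ^ q ≤ t}, ENNReal.ofReal (x i ^ 2) := by
      rw [restrict_Ioi_eq_restrict_Ici, ← lintegral_indicator measurableSet_Ici]
      refine lintegral_congr fun t => ?_
      by_cases h : 0 ≤ t
      · simp [Set.indicator, h]
      · have : {x : Fin n → ℝ | ∑ k, |x k| ^ q ≤ t} = ∅ := by
          refine Set.eq_empty_of_forall_notMem fun x hx => h (le_trans ?_ hx)
          positivity
        simp [Set.indicator, h, this]
    _ = ∫⁻ t in Set.Ioi (0 : ℝ), ENNReal.ofReal (Real.exp (-t) * t ^ (((n : ℝ) + 2) / q)) *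
        ∫⁻ x in {x : Fin n → ℝ | ∑ k, |x k| ^ q ≤ 1}, ENNReal.ofReal (x i ^ 2) := by
      refine setLIntegral_congr_fun measurableSet_Ioi fun t ht => ?_
      rw [setLIntegral_sq_sum_rpow_le hq i ht, ENNReal.ofReal_mul (Real.exp_pos _).le, mul_assoc]
    _ = _ := by
      have hpos : 0 < 1 + ((n : ℝ) + 2) / q := by positivity
      rw [lintegral_mul_const _ (by fun_prop), Real.Gamma_eq_integral hpos]
      congr 1
      have hint := Real.GammaIntegral_convergent hpos
      rw [add_sub_cancel_left] at hint ⊢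
      rw [ofReal_integral_eq_lintegral_ofReal hint]
      exact (ae_restrict_mem measurableSet_Ioi).mono fun t (ht : 0 < t) => by
        simp only [Pi.zero_apply]; positivity

theorem volume_lqBall {n : ℕ} (hn : 0 < n) {q : ℝ} (hq : 1 ≤ q) :
    volume (lqBall n q) = ENNReal.ofReal
      ((2 * Real.Gamma (1 + 1 / q)) ^ n / Real.Gamma (1 + (n : ℝ) / q)) := by
  have : Nonempty (Fin n) := ⟨⟨0, hn⟩⟩
  have h : lqBall n q = WithLp.ofLp ⁻¹' {x : Fin n → ℝ | (∑ i, |x i| ^ q) ^ (1 / q) ≤ 1} := by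
    ext x
    simp only [lqBall, Set.mem_ofPred_eq, Set.mem_preimage]
    rw [rpow_le_one_iff_of_nonneg (by positivity) (by positivity)]
  rw [h, (PiLp.volume_preserving_ofLp (Fin n)).measure_preimage_emb
      (MeasurableEquiv.toLp 2 (Fin n → ℝ)).symm.measurableEmbedding,
    volume_sum_rpow_le (Fin n) hq]
  simp [add_comm]

theorem measurableSet_lqBall (n : ℕ) (q : ℝ) : MeasurableSet (lqBall n q) :=
  measurableSet_le (by fun_prop) measurable_const

theorem setIntegral_sq_lqBall {n : ℕ} {q : ℝ} (hq : 0 < q) (i : Fin n) :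
    ∫ x in lqBall n q, x i ^ 2 =
      2 / 3 * Real.Gamma (1 + 3 / q) * (2 * Real.Gamma (1 + 1 / q)) ^ (n - 1) /
        Real.Gamma (1 + ((n : ℝ) + 2) / q) := by
  have hΓ : 0 < Real.Gamma (1 + ((n : ℝ) + 2) / q) := Real.Gamma_pos_of_pos (by positivity)
  have htransfer : ∫ x in lqBall n q, x i ^ 2 =
      ∫ x in {x : Fin n → ℝ | ∑ k, |x k| ^ q ≤ 1}, x i ^ 2 :=
    (PiLp.volume_preserving_ofLp (Fin n)).setIntegral_preimage_emb
      (MeasurableEquiv.toLp 2 (Fin n → ℝ)).symm.measurableEmbedding (fun x => x i ^ 2)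
      {x : Fin n → ℝ | ∑ k, |x k| ^ q ≤ 1}
  rw [eq_div_iff hΓ.ne', htransfer, ← integral_sq_mul_exp_neg_sum_rpow hq i,
    integral_eq_lintegral_of_nonneg_ae (Filter.Eventually.of_forall fun x => sq_nonneg _)
      (Measurable.aestronglyMeasurable (by fun_prop)),
    integral_eq_lintegral_of_nonneg_ae (Filter.Eventually.of_forall fun x =>
      mul_nonneg (sq_nonneg _) (Real.exp_pos _).le)
      (Measurable.aestronglyMeasurable (by fun_prop)),
    lintegral_sq_mul_exp_neg_sum_rpow hq i, ENNReal.toReal_mul, ENNReal.toReal_ofReal hΓ.le, mul_comm]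

theorem convex_lqBall_one (n : ℕ) : Convex ℝ (lqBall n 1) := by
  intro x hx y hy a b ha hb hab
  simp only [lqBall, Set.mem_ofPred_eq, Real.rpow_one, PiLp.add_apply, PiLp.smul_apply,
    smul_eq_mul] at *
  calc
    ∑ i, |a * x i + b * y i| ≤ ∑ i, (a * |x i| + b * |y i|) := by
      refine Finset.sum_le_sum fun i _ => (abs_add_le _ _).trans_eq ?_
      rw [abs_mul, abs_mul, abs_of_nonneg ha, abs_of_nonneg hb]
    _ = a * ∑ i, |x i| + b * ∑ i, |y i| := by
      rw [Finset.sum_add_distrib, Finset.mul_sum, Finset.mul_sum]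
    _ ≤ 1 := by nlinarith

theorem sum_smul_mem_of_sum_abs_le_one {E ι : Type*} [AddCommGroup E] [Module ℝ E] [Fintype ι]
    {s : Set E} (hs : Convex ℝ s) (h0 : (0 : E) ∈ s) {c : ι → ℝ} (hc : ∑ i, |c i| ≤ 1)
    {z : ι → E} (hz : ∀ i, z i ∈ s) (hz' : ∀ i, -z i ∈ s) : ∑ i, c i • z i ∈ s := by
  have h := hs.sum_mem (t := Finset.univ)
    (w := fun o : Option ι => o.elim (1 - ∑ i, |c i|) fun i => |c i|)
    (z := fun o : Option ι => o.elim 0 fun i => if 0 ≤ c i then z i else -z i)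
    (by rintro (_ | i) - <;> simp [hc]) (by simp [Fintype.sum_option])
    (by rintro (_ | i) -
        · exact h0
        · dsimp only [Option.elim]
          split_ifs
          exacts [hz i, hz' i])
  convert h using 1
  simp only [Fintype.sum_option, Option.elim, smul_zero, zero_add]
  refine Finset.sum_congr rfl fun i _ => ?_
  split_ifs with hi
  · rw [abs_of_nonneg hi]
  · rw [abs_of_neg (not_le.1 hi), smul_neg, neg_smul, neg_neg]

theorem convexHull_range_union_neg_eq_image {n : ℕ} (hn : 0 < n)
    (x : Fin n → EuclideanSpace ℝ (Fin n)) :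
    convexHull ℝ (Set.range x ∪ -Set.range x) =
      Matrix.toLpLin 2 2 (Matrix.of fun i j => x j i) '' lqBall n 1 := by
  have hf (c : EuclideanSpace ℝ (Fin n)) :
      Matrix.toLpLin 2 2 (Matrix.of fun i j => x j i) c = ∑ j, c j • x j := by
    ext i
    simp [Matrix.toLpLin_apply, Matrix.mulVec, dotProduct, mul_comm]
  have hsingle (j : Fin n) :
      Matrix.toLpLin 2 2 (Matrix.of fun i j => x j i) (EuclideanSpace.single j 1) = x j := by
    simp [hf]
  have hmem (j : Fin n) : EuclideanSpace.single j (1 : ℝ) ∈ lqBall n 1 := by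
    simp [lqBall, apply_ite]
  have hmem_neg (j : Fin n) : -EuclideanSpace.single j (1 : ℝ) ∈ lqBall n 1 := by
    simpa [lqBall] using hmem j
  refine Set.Subset.antisymm (convexHull_min ?_ ((convex_lqBall_one n).linear_image _)) ?_
  · rintro y (⟨j, rfl⟩ | ⟨j, hj⟩)
    · exact ⟨_, hmem j, hsingle j⟩
    · exact ⟨_, hmem_neg j, by rw [map_neg, hsingle, hj, neg_neg]⟩
  · rintro _ ⟨c, hc, rfl⟩
    have hx (j : Fin n) : x j ∈ convexHull ℝ (Set.range x ∪ -Set.range x) :=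
      subset_convexHull ℝ _ (Or.inl ⟨j, rfl⟩)
    have hx_neg (j : Fin n) : -x j ∈ convexHull ℝ (Set.range x ∪ -Set.range x) :=
      subset_convexHull ℝ _ (Or.inr (by simp))
    have h0 : (0 : EuclideanSpace ℝ (Fin n)) ∈ convexHull ℝ (Set.range x ∪ -Set.range x) := by
      simpa using (convex_convexHull ℝ _).midpoint_mem (hx ⟨0, hn⟩) (hx_neg ⟨0, hn⟩)
    rw [hf]
    exact sum_smul_mem_of_sum_abs_le_one (convex_convexHull ℝ _) h0
      (by simpa [lqBall] using hc) hx hx_neg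

theorem volume_convexHull_range_union_neg {n : ℕ} (hn : 0 < n)
    (x : Fin n → EuclideanSpace ℝ (Fin n)) :
    (volume (convexHull ℝ (Set.range x ∪ -Set.range x))).toReal =
      2 ^ n / n.factorial * |(Matrix.of fun i j => x i j).det| := by
  rw [convexHull_range_union_neg_eq_image hn, Measure.addHaar_image_linearMap,
    LinearMap.det_toLpLin, volume_lqBall hn le_rfl, ENNReal.toReal_mul,
    ENNReal.toReal_ofReal (abs_nonneg _), mul_comm,
    ← Matrix.det_transpose (Matrix.of fun i j => x i j)]
  have h1 : Real.Gamma (1 + 1 / 1) = 1 := by norm_num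
  have h2 : Real.Gamma (1 + (n : ℝ) / 1) = n.factorial := by
    rw [div_one, add_comm, Real.Gamma_nat_eq_factorial]
  rw [h1, h2, mul_one, ENNReal.toReal_ofReal (by positivity)]
  rfl

theorem integral_det_sq_pi_s8 {n : ℕ} (μ : Measure (EuclideanSpace ℝ (Fin n))) [SigmaFinite μ]
    (s : ℝ) (hint : ∀ a b, Integrable (fun y : EuclideanSpace ℝ (Fin n) => y a * y b) μ)
    (hcov : ∀ a b, ∫ y, y a * y b ∂μ = if a = b then s else 0) :
    ∫ x : Fin n → EuclideanSpace ℝ (Fin n), (Matrix.of fun i j => x i j).det ^ 2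
      ∂(Measure.pi fun _ => μ) = n.factorial * s ^ n := by
  have hexpand (x : Fin n → EuclideanSpace ℝ (Fin n)) :
      (Matrix.of fun i j => x i j).det ^ 2 =
        ∑ σ : Equiv.Perm (Fin n), ∑ τ : Equiv.Perm (Fin n),
          ((Equiv.Perm.sign σ : ℤ) * (Equiv.Perm.sign τ : ℤ) : ℝ) *
            ∏ i, x i (σ i) * x i (τ i) := by
    rw [← Matrix.det_transpose, Matrix.det_apply', sq, Finset.sum_mul_sum]
    refine Finset.sum_congr rfl fun σ _ => Finset.sum_congr rfl fun τ _ => ?_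
    rw [Finset.prod_mul_distrib]
    simp only [Matrix.transpose_apply, Matrix.of_apply]
    ring
  have hprod (σ τ : Equiv.Perm (Fin n)) :
      Integrable (fun x : Fin n → EuclideanSpace ℝ (Fin n) => ∏ i, x i (σ i) * x i (τ i))
        (Measure.pi fun _ => μ) :=
    Integrable.fintype_prod (f := fun i (y : EuclideanSpace ℝ (Fin n)) => y (σ i) * y (τ i))
      fun i => hint _ _
  simp_rw [hexpand]
  rw [integral_finsetSum _ fun σ _ => integrable_finsetSum _ fun τ _ => (hprod σ τ).const_mul _]
  have hterm (σ : Equiv.Perm (Fin n)) :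
      ∫ x : Fin n → EuclideanSpace ℝ (Fin n), ∑ τ : Equiv.Perm (Fin n),
        ((Equiv.Perm.sign σ : ℤ) * (Equiv.Perm.sign τ : ℤ) : ℝ) * ∏ i, x i (σ i) * x i (τ i)
          ∂(Measure.pi fun _ => μ) = s ^ n := by
    rw [integral_finsetSum _ fun τ _ => (hprod σ τ).const_mul _, Finset.sum_eq_single σ]
    · rw [integral_const_mul, integral_fintype_prod_eq_prod
        (fun i (y : EuclideanSpace ℝ (Fin n)) => y (σ i) * y (σ i))]
      have hsign : ((Equiv.Perm.sign σ : ℤ) * (Equiv.Perm.sign σ : ℤ) : ℝ) = 1 := by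
        exact_mod_cast Int.units_coe_mul_self (Equiv.Perm.sign σ)
      simp [hcov, hsign]
    · intro τ _ hne
      obtain ⟨i, hi⟩ : ∃ i, σ i ≠ τ i := by
        by_contra! h
        exact hne (Equiv.ext fun i => (h i).symm)
      rw [integral_const_mul, integral_fintype_prod_eq_prod
        (fun i (y : EuclideanSpace ℝ (Fin n)) => y (σ i) * y (τ i)),
        Finset.prod_eq_zero (Finset.mem_univ i) (by rw [hcov, if_neg hi]), mul_zero]
    · simp
  simp_rw [hterm]
  simp [Fintype.card_perm]

theorem setIntegral_mul_lqBall_of_ne {n : ℕ} (q : ℝ) {a b : Fin n} (hab : a ≠ b) :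
    ∫ y in lqBall n q, y a * y b = 0 := by
  let e : EuclideanSpace ℝ (Fin n) ≃ₗᵢ[ℝ] EuclideanSpace ℝ (Fin n) :=
    LinearIsometryEquiv.piLpCongrRight 2 fun k =>
      if k = a then LinearIsometryEquiv.neg ℝ else LinearIsometryEquiv.refl ℝ ℝ
  have he (y : EuclideanSpace ℝ (Fin n)) (k : Fin n) : e y k = if k = a then -y k else y k := by
    simp only [e, LinearIsometryEquiv.piLpCongrRight_apply]
    split_ifs <;> simp
  have hset : e ⁻¹' lqBall n q = lqBall n q := by
    ext y
    have (k : Fin n) : |e y k| = |y k| := by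
      rw [he]
      split_ifs <;> simp
    simp [lqBall, this]
  have h := e.measurePreserving.setIntegral_preimage_emb
    e.toHomeomorph.measurableEmbedding (fun y => y a * y b) (lqBall n q)
  rw [hset] at h
  simp only [he, if_pos, if_neg hab.symm, neg_mul, integral_neg] at h
  linarith

theorem integrableOn_mul_lqBall {n : ℕ} (hn : 0 < n) {q : ℝ} (hq : 1 ≤ q) (a b : Fin n) :
    IntegrableOn (fun y => y a * y b) (lqBall n q) := by
  have hle {y : EuclideanSpace ℝ (Fin n)} (hy : y ∈ lqBall n q) (k : Fin n) : |y k| ≤ 1 := by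
    have h : |y k| ^ q ≤ 1 := le_trans
      (Finset.single_le_sum (f := fun k => |y k| ^ q) (fun _ _ => by positivity)
        (Finset.mem_univ k)) hy
    rwa [rpow_le_one_iff_of_nonneg (abs_nonneg _) (by linarith)] at h
  refine Measure.integrableOn_of_bounded (M := 1) (by simp [volume_lqBall hn hq]) (by fun_prop) ?_
  refine (ae_restrict_mem (measurableSet_lqBall n q)).mono fun y hy => ?_
  rw [Real.norm_eq_abs, abs_mul]
  exact mul_le_one₀ (hle hy a) (abs_nonneg _) (hle hy b)

/-- For `1 ≤ q < ∞`,
`𝔼 V_{B_qⁿ}² = (1/n!) (Γ(1+3/q) Γ(1+n/q) / (3 Γ(1+1/q)³ Γ(1+(n+2)/q)))ⁿ Γ(1+n/q)²`. -/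
theorem second_moment_randCrossVol_lqBall
    (n : ℕ) (hn : 0 < n) (q : ℝ) (hq : 1 ≤ q) :
    ∫ x, randCrossVol n (lqBall n q) x ^ 2 ∂(jointUnif n n (lqBall n q)) =
      (1 / (n.factorial : ℝ)) *
        (Real.Gamma (1 + 3 / q) * Real.Gamma (1 + (n : ℝ) / q) /
            (3 * Real.Gamma (1 + 1 / q) ^ 3 * Real.Gamma (1 + ((n : ℝ) + 2) / q))) ^ n *
        Real.Gamma (1 + (n : ℝ) / q) ^ 2 := by
  have hq0 : 0 < q := by linarith
  have hΓ {t : ℝ} (ht : 0 ≤ t) : 0 < Real.Gamma (1 + t) := Real.Gamma_pos_of_pos (by linarith)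
  have hΓ1 : 0 < Real.Gamma (1 + 1 / q) := hΓ (by positivity)
  have hΓn : 0 < Real.Gamma (1 + (n : ℝ) / q) := hΓ (by positivity)
  have hΓn2 : 0 < Real.Gamma (1 + ((n : ℝ) + 2) / q) := hΓ (by positivity)
  set V : ℝ := (2 * Real.Gamma (1 + 1 / q)) ^ n / Real.Gamma (1 + (n : ℝ) / q) with hV
  have hV0 : 0 < V := by positivity
  have hvol : volume (lqBall n q) = ENNReal.ofReal V := volume_lqBall hn hq
  have hinv : (ENNReal.ofReal V)⁻¹ ≠ ⊤ := by simp [hV0]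
  have : IsFiniteMeasure (unifMeasure n (lqBall n q)) := ⟨by
    rw [unifMeasure, hvol, Measure.smul_apply, Measure.restrict_apply_univ, hvol, smul_eq_mul]
    exact ENNReal.mul_lt_top hinv.lt_top ENNReal.ofReal_lt_top⟩
  have hdet := integral_det_sq_pi_s8 (unifMeasure n (lqBall n q))
    (V⁻¹ * (2 / 3 * Real.Gamma (1 + 3 / q) * (2 * Real.Gamma (1 + 1 / q)) ^ (n - 1) /
        Real.Gamma (1 + ((n : ℝ) + 2) / q)))
    (fun a b => by
      rw [unifMeasure, hvol]
      exact Integrable.smul_measure (integrableOn_mul_lqBall hn hq a b) hinv)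
    (fun a b => by
      rw [unifMeasure, hvol, integral_smul_measure, ENNReal.toReal_inv,
        ENNReal.toReal_ofReal hV0.le, smul_eq_mul]
      split_ifs with hab
      · subst hab
        simp_rw [← sq]
        rw [setIntegral_sq_lqBall hq0]
      · rw [setIntegral_mul_lqBall_of_ne q hab, mul_zero])
  have hsq (x : Fin n → EuclideanSpace ℝ (Fin n)) : randCrossVol n (lqBall n q) x ^ 2 =
      (2 ^ n / n.factorial / V) ^ 2 * (Matrix.of fun i j => x i j).det ^ 2 := by
    rw [randCrossVol, volume_convexHull_range_union_neg hn, hvol, ENNReal.toReal_ofReal hV0.le,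
      ← sq_abs (Matrix.det _)]
    ring
  simp_rw [hsq]
  rw [integral_const_mul, jointUnif, hdet]
  have hmoment : V⁻¹ * (2 / 3 * Real.Gamma (1 + 3 / q) * (2 * Real.Gamma (1 + 1 / q)) ^ (n - 1) /
        Real.Gamma (1 + ((n : ℝ) + 2) / q)) =
      Real.Gamma (1 + 3 / q) * Real.Gamma (1 + (n : ℝ) / q) /
        (3 * Real.Gamma (1 + 1 / q) * Real.Gamma (1 + ((n : ℝ) + 2) / q)) := by
    obtain ⟨m, rfl⟩ : ∃ m, n = m + 1 := ⟨n - 1, by omega⟩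
    rw [hV, Nat.add_sub_cancel, pow_succ]
    field_simp
  rw [hmoment, hV]
  simp only [div_pow, mul_pow]
  field_simp
  ring
end
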